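/- arXiv:2504.17764 — 5 statements merged into one kernel-verified Lean document; each statement's English description precedes it below -/
import Mathlib

section
/- Let (C, d) be a dagger category, regarded as the O(1)-volutive category (C, d, id) with identity natural isomorphism. The objects of the strictification S(C, d, id) are exactly the pairs (a, θ) with θ : a → a a self-adjoint automorphism of (C, d), and its dagger sends X : (a, θ) → (b, θ') to θ⁻¹ ∘ d(X) ∘ θ'. Then: (i) the functor ι : C → S(C, d, id) given by a ↦ (a, id_a) and X ↦ X is a well-defined fully faithful dagger functor; (ii) if every self-adjoint automorphism of (C, d) is positive, then every object of S(C, d, id) is unitarily isomorphic in S(C, d, id) to an object in the image of ι. -/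
/-!
STATEMENT 0: Strictification of the O(1)-volutive category associated to a dagger
category `(C, d)`.
-/

open CategoryTheory

universe v u

/-- A dagger structure on a category: a contravariant, identity-on-objects endofunctor
squaring to the identity. -/
structure DaggerStruct (C : Type u) [Category.{v} C] where
  dag : ∀ {x y : C}, (x ⟶ y) → (y ⟶ x)
  dag_id : ∀ x : C, dag (𝟙 x) = 𝟙 x
  dag_comp : ∀ {x y z : C} (f : x ⟶ y) (g : y ⟶ z), dag (f ≫ g) = dag g ≫ dag f
  dag_dag : ∀ {x y : C} (f : x ⟶ y), dag (dag f) = f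

/-- An O(1)-volution on a category: a contravariant endofunctor `d` together with a natural
isomorphism `η : d ∘ d ≅ id` such that `d (η_a) = η_{d a}⁻¹`. -/
structure OneVolution (C : Type u) [Category.{v} C] where
  obj : C → C
  map : ∀ {x y : C}, (x ⟶ y) → (obj y ⟶ obj x)
  map_id : ∀ x : C, map (𝟙 x) = 𝟙 (obj x)
  map_comp : ∀ {x y z : C} (f : x ⟶ y) (g : y ⟶ z), map (f ≫ g) = map g ≫ map f
  η : ∀ a : C, obj (obj a) ≅ a
  η_natural : ∀ {x y : C} (u : x ⟶ y), map (map u) ≫ (η y).hom = (η x).hom ≫ u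
  η_coherence : ∀ a : C, map (η a).hom = (η (obj a)).inv

variable {C : Type u} [Category.{v} C]

/-- A dagger category trivially reinterpreted as an O(1)-volutive category `(C, d, id)`. -/
def DaggerStruct.toVolution (D : DaggerStruct C) : OneVolution C where
  obj a := a
  map f := D.dag f
  map_id := D.dag_id
  map_comp := fun f g => D.dag_comp f g
  η a := Iso.refl a
  η_natural u := by simp [D.dag_dag]
  η_coherence a := by simp [D.dag_id]

/-- Objects of the strictification `S(C, d, η)`: objects of `C` equipped with a fixed-point
structure. -/
structure FixedPoint (V : OneVolution C) where
  pt : C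
  θ : pt ≅ V.obj pt
  cond : θ.hom ≫ V.map θ.inv ≫ (V.η pt).hom = 𝟙 pt

instance (V : OneVolution C) : Category (FixedPoint V) where
  Hom A B := A.pt ⟶ B.pt
  id A := 𝟙 A.pt
  comp f g := f ≫ g
  id_comp f := Category.id_comp f
  comp_id f := Category.comp_id f
  assoc f g h := Category.assoc f g h

/-- The dagger of the strictification: `X : (a, θ) ⟶ (b, θ')` is sent to
`θ⁻¹ ∘ d(X) ∘ θ'`. -/
def sdag {V : OneVolution C} {A B : FixedPoint V} (X : A ⟶ B) : B ⟶ A :=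
  show B.pt ⟶ A.pt from B.θ.hom ≫ V.map (X : A.pt ⟶ B.pt) ≫ A.θ.inv

/-- The object `(a, id_a)` of the strictification of `(C, d, id)`. -/
def inclObj (D : DaggerStruct C) (a : C) : FixedPoint D.toVolution :=
  ⟨a, Iso.refl a, by simp [DaggerStruct.toVolution, D.dag_id]⟩

/-- The inclusion functor `ι : C ⟶ S(C, d, id)`, `a ↦ (a, id_a)`, `X ↦ X`. -/
def incl (D : DaggerStruct C) : C ⥤ FixedPoint D.toVolution where
  obj := inclObj D
  map f := f
  map_id _ := rfl
  map_comp _ _ := rfl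

namespace DaggerStruct

lemma dag_inv_comp_dag_hom (D : DaggerStruct C) {x y : C} (e : x ≅ y) :
    D.dag e.inv ≫ D.dag e.hom = 𝟙 x := by
  rw [← D.dag_comp, e.hom_inv_id, D.dag_id]

lemma dag_hom_comp_dag_inv (D : DaggerStruct C) {x y : C} (e : x ≅ y) :
    D.dag e.hom ≫ D.dag e.inv = 𝟙 y := by
  rw [← D.dag_comp, e.inv_hom_id, D.dag_id]

lemma fixedPoint_condition_iff (D : DaggerStruct C) {a : C} (θ : a ≅ a) :
    θ.hom ≫ D.toVolution.map θ.inv ≫ (D.toVolution.η a).hom = 𝟙 a ↔ D.dag θ.hom = θ.hom := by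
  change θ.hom ≫ D.dag θ.inv ≫ 𝟙 a = 𝟙 a ↔ _
  rw [Category.comp_id]
  constructor
  · intro h
    calc D.dag θ.hom = (θ.hom ≫ D.dag θ.inv) ≫ D.dag θ.hom := by rw [h, Category.id_comp]
      _ = θ.hom := by rw [Category.assoc, D.dag_inv_comp_dag_hom, Category.comp_id]
  · intro h
    rw [← D.dag_hom_comp_dag_inv θ, h]

/-- A factorization `θ = d(g) ∘ g` makes `g` unitary from `(a, θ)` to `(b, id_b)`. -/
lemma unitary_of_eq_comp_dag (D : DaggerStruct C) {a b : C} (θ : a ≅ a) (g : a ≅ b)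
    (h : θ.hom = g.hom ≫ D.dag g.hom) :
    g.hom ≫ D.dag g.hom ≫ θ.inv = 𝟙 a ∧ (D.dag g.hom ≫ θ.inv) ≫ g.hom = 𝟙 b := by
  have hg : g.hom ≫ D.dag g.hom ≫ θ.inv = 𝟙 a := by
    rw [← Category.assoc, ← h, θ.hom_inv_id]
  refine ⟨hg, ?_⟩
  rw [← cancel_epi g.hom, ← Category.assoc, hg, Category.id_comp, Category.comp_id]

end DaggerStruct

lemma sdag_to_inclObj (D : DaggerStruct C) (A : FixedPoint D.toVolution) {b : C}
    (u : A ⟶ inclObj D b) :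
    sdag u = (show b ⟶ A.pt from D.dag (show A.pt ⟶ b from u) ≫ A.θ.inv) :=
  Category.id_comp (show b ⟶ A.pt from D.dag (show A.pt ⟶ b from u) ≫ A.θ.inv)

/-- For a dagger category `(C, d)` regarded as the O(1)-volutive category
`(C, d, id)`:
(objects) the fixed-point structures on `a` are exactly the self-adjoint automorphisms of `a`;
(i) `ι : C ⟶ S(C, d, id)` is a well-defined fully faithful dagger functor;
(ii) if every self-adjoint automorphism of `(C, d)` is positive, then every object of
`S(C, d, id)` is unitarily isomorphic to an object in the image of `ι`. -/
theorem statement0 (D : DaggerStruct C) :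
    (∀ (a : C) (θ : a ≅ a),
      (θ.hom ≫ D.toVolution.map θ.inv ≫ (D.toVolution.η a).hom = 𝟙 a) ↔ D.dag θ.hom = θ.hom)
    ∧ (incl D).Full
    ∧ (incl D).Faithful
    ∧ (∀ {a b : C} (X : a ⟶ b), (incl D).map (D.dag X) = sdag ((incl D).map X))
    ∧ ((∀ (a : C) (f : a ⟶ a), IsIso f → D.dag f = f →
          ∃ (b : C) (g : a ≅ b), f = g.hom ≫ D.dag g.hom) →
        ∀ A : FixedPoint D.toVolution, ∃ (b : C) (u : A ⟶ (incl D).obj b),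
          u ≫ sdag u = 𝟙 A ∧ sdag u ≫ u = 𝟙 ((incl D).obj b)) := by
  refine ⟨fun a θ => D.fixedPoint_condition_iff θ, ⟨fun f => ⟨f, rfl⟩⟩, ⟨fun h => h⟩, ?_, ?_⟩
  · intro a b X
    rw [show sdag ((incl D).map X) = _ from sdag_to_inclObj D (inclObj D a) X]
    exact (Category.comp_id (D.dag X)).symm
  · intro hpos A
    let θ : A.pt ≅ A.pt := A.θ
    obtain ⟨b, g, hg⟩ := hpos A.pt θ.hom inferInstance
      ((D.fixedPoint_condition_iff θ).mp A.cond)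
    obtain ⟨h₁, h₂⟩ := D.unitary_of_eq_comp_dag θ g hg
    have hu := sdag_to_inclObj D A g.hom
    exact ⟨b, g.hom, (congrArg (fun w : b ⟶ A.pt => g.hom ≫ w) hu).trans h₁,
      (congrArg (fun w : b ⟶ A.pt => w ≫ g.hom) hu).trans h₂⟩
end

section
/- Let (C, d, η) be an O(1)-volutive category and let d_S denote the dagger of its strictification S(C, d, η), given by d_S(X) = θ_a⁻¹ ∘ d(X) ∘ θ_b for X : (a, θ_a) → (b, θ_b). Then every self-adjoint automorphism of the dagger category (S(C, d, η), d_S) is positive: for every isomorphism f : (a, θ_a) → (a, θ_a) with d_S(f) = f, there exist an object (b, θ_b) of S(C, d, η) and an isomorphism g : (a, θ_a) → (b, θ_b) with f = d_S(g) ∘ g. -/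
open CategoryTheory

universe v u

variable {C : Type u} [Category.{v} C]

/-- Composing the fixed-point structure of `A` with a self-adjoint automorphism of `A` yields
another fixed-point structure on the same underlying object. -/
def FixedPoint.twist {V : OneVolution C} (A : FixedPoint V) (e : A.pt ≅ A.pt)
    (he : A.θ.hom ≫ V.map e.hom ≫ A.θ.inv = e.hom) : FixedPoint V where
  pt := A.pt
  θ := e ≪≫ A.θ
  cond := by
    have h : e.hom ≫ A.θ.hom = A.θ.hom ≫ V.map e.hom := by
      rw [← Iso.eq_comp_inv, Category.assoc, he]
    have h' : V.map e.hom ≫ V.map e.inv = 𝟙 _ := by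
      rw [← V.map_comp, e.inv_hom_id, V.map_id]
    simp only [Iso.trans_hom, Iso.trans_inv, V.map_comp, Category.assoc]
    rw [← Category.assoc, h, Category.assoc, ← Category.assoc (V.map e.hom), h', Category.id_comp,
      A.cond]

/-- STATEMENT 2.  Every self-adjoint automorphism of the dagger category
`(S(C, d, η), d_S)` is positive: for every isomorphism `f : (a, θ_a) ⟶ (a, θ_a)` with
`d_S(f) = f` there are an object `(b, θ_b)` and an isomorphism `g : (a, θ_a) ⟶ (b, θ_b)`
with `f = d_S(g) ∘ g`. -/
theorem statement2 (V : OneVolution C) (A : FixedPoint V) (f : A ⟶ A)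
    (hiso : IsIso f) (hself : sdag f = f) :
    ∃ (B : FixedPoint V) (g : A ≅ B), f = g.hom ≫ sdag g.hom := by
  obtain ⟨f', hl, hr⟩ := hiso.out
  refine ⟨A.twist ⟨f, f', hl, hr⟩ hself, ⟨𝟙 A.pt, 𝟙 A.pt, Category.comp_id (𝟙 A.pt),
    Category.comp_id (𝟙 A.pt)⟩, ?_⟩
  change (f : A.pt ⟶ A.pt) = 𝟙 A.pt ≫ ((f : A.pt ⟶ A.pt) ≫ A.θ.hom) ≫ V.map (𝟙 A.pt) ≫ A.θ.inv
  rw [V.map_id, Category.id_comp, Category.id_comp, Category.assoc, A.θ.hom_inv_id]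
  exact (Category.comp_id (X := A.pt) (Y := A.pt) f).symm
end

section
/- Let (C, d, η) be an O(1)-volutive category. Then the assignment sending a morphism X : (a, θ_a) → (b, θ_b) of the strictification S(C, d, η) to θ_a⁻¹ ∘ d(X) ∘ θ_b : (b, θ_b) → (a, θ_a) is a dagger structure on S(C, d, η): it preserves identities, reverses composition, fixes all objects, and is involutive, i.e. applying it twice to any morphism returns that morphism. -/
open CategoryTheory

universe v u

variable {C : Type u} [Category.{v} C]

lemma OneVolution.map_inv_map_hom (V : OneVolution C) {x y : C} (e : x ≅ y) :
    V.map e.inv ≫ V.map e.hom = 𝟙 (V.obj x) := by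
  rw [← V.map_comp, e.hom_inv_id, V.map_id]

lemma FixedPoint.θ_hom_map_inv {V : OneVolution C} (A : FixedPoint V) :
    A.θ.hom ≫ V.map A.θ.inv = (V.η A.pt).inv := by
  rw [← cancel_mono (V.η A.pt).hom, Iso.inv_hom_id, Category.assoc, A.cond]

lemma FixedPoint.map_hom_θ_inv {V : OneVolution C} (A : FixedPoint V) :
    V.map A.θ.hom ≫ A.θ.inv = (V.η A.pt).hom := by
  rw [← cancel_epi (V.η A.pt).inv, Iso.inv_hom_id, ← A.θ_hom_map_inv, Category.assoc,
    reassoc_of% V.map_inv_map_hom A.θ, Iso.hom_inv_id]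

/-- STATEMENT 3.  For any O(1)-volutive category `(C, d, η)`, the assignment
`X : (a, θ_a) ⟶ (b, θ_b) ↦ θ_a⁻¹ ∘ d(X) ∘ θ_b` is a dagger structure on the strictification
`S(C, d, η)`: it preserves identities, reverses composition, and is involutive.  (It fixes all
objects by construction, sending a morphism `(a, θ_a) ⟶ (b, θ_b)` to a morphism
`(b, θ_b) ⟶ (a, θ_a)`.) -/
theorem statement3 (V : OneVolution C) :
    (∀ A : FixedPoint V, sdag (𝟙 A) = 𝟙 A)
    ∧ (∀ {A B E : FixedPoint V} (f : A ⟶ B) (g : B ⟶ E), sdag (f ≫ g) = sdag g ≫ sdag f)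
    ∧ (∀ {A B : FixedPoint V} (f : A ⟶ B), sdag (sdag f) = f) := by
  refine ⟨fun A => ?_, fun {A B E} f g => ?_, fun {A B} f => ?_⟩
  · change A.θ.hom ≫ V.map (𝟙 A.pt) ≫ A.θ.inv = 𝟙 A.pt
    rw [V.map_id, Category.id_comp, Iso.hom_inv_id]
  · change A.pt ⟶ B.pt at f
    change B.pt ⟶ E.pt at g
    change E.θ.hom ≫ V.map (f ≫ g) ≫ A.θ.inv =
      (E.θ.hom ≫ V.map g ≫ B.θ.inv) ≫ B.θ.hom ≫ V.map f ≫ A.θ.inv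
    simp [V.map_comp]
  · change A.pt ⟶ B.pt at f
    change A.θ.hom ≫ V.map (B.θ.hom ≫ V.map f ≫ A.θ.inv) ≫ B.θ.inv = f
    simp only [V.map_comp, Category.assoc]
    rw [B.map_hom_θ_inv, V.η_natural, reassoc_of% A.θ_hom_map_inv, Iso.inv_hom_id_assoc]
end

section
/- Let B be a bicategory, A a Δ-separable Frobenius algebra on an object a of B, X : a → b a right A-module with action ρ_X : X ⊗ A → X, and Y : c → a a left A-module with action ρ_Y : A ⊗ Y → Y. Then the 2-morphism e := (ρ_X ⊗ ρ_Y) ∘ (id_X ⊗ (Δ ∘ η) ⊗ id_Y) : X ⊗ Y → X ⊗ Y (with associators and unitors of B inserted as appropriate) satisfies e ∘ e = e. -/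
open CategoryTheory Bicategory

universe w v u

variable {B : Type u} [Bicategory.{w, v} B]

/-!  We work in a bicategory `B`.  For 1-morphisms `F : x ⟶ y`, `G : y ⟶ z` the horizontal
composite is written `F ≫ G`; it corresponds to the tensor product `G ⊗ F` in the paper's
(right-to-left) notation.  Vertical composition of 2-morphisms is also written `≫`, and
`◁`, `▷` denote whiskering. -/

/-- The data of a Δ-separable Frobenius algebra on an object `a` of a bicategory: an
associative unital algebra `(A, μ, η)` and a coassociative counital coalgebra `(A, Δ, ε)`
satisfying the Frobenius relation and Δ-separability. -/
structure FrobeniusAlgebra {a : B} (A : a ⟶ a) where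
  mul : A ≫ A ⟶ A
  one : 𝟙 a ⟶ A
  comul : A ⟶ A ≫ A
  counit : A ⟶ 𝟙 a
  mul_assoc : (A ◁ mul) ≫ mul = (α_ A A A).inv ≫ (mul ▷ A) ≫ mul
  one_mul : (λ_ A).inv ≫ (one ▷ A) ≫ mul = 𝟙 A
  mul_one : (ρ_ A).inv ≫ (A ◁ one) ≫ mul = 𝟙 A
  comul_coassoc : comul ≫ (A ◁ comul) = comul ≫ (comul ▷ A) ≫ (α_ A A A).hom
  comul_counit : comul ≫ (A ◁ counit) ≫ (ρ_ A).hom = 𝟙 A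
  counit_comul : comul ≫ (counit ▷ A) ≫ (λ_ A).hom = 𝟙 A
  frobenius : (A ◁ comul) ≫ (α_ A A A).inv ≫ (mul ▷ A)
    = (comul ▷ A) ≫ (α_ A A A).hom ≫ (A ◁ mul)
  separable : comul ≫ mul = 𝟙 A

/-- A right `A`-module structure on `X : a ⟶ b` (in the paper's notation the action is a
2-morphism `X ⊗ A ⟶ X`, i.e. `A ≫ X ⟶ X`). -/
structure RightModule {a b : B} {A : a ⟶ a} (FA : FrobeniusAlgebra A) (X : a ⟶ b) where
  act : A ≫ X ⟶ X
  act_assoc : (A ◁ act) ≫ act = (α_ A A X).inv ≫ (FA.mul ▷ X) ≫ act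
  act_one : (λ_ X).inv ≫ (FA.one ▷ X) ≫ act = 𝟙 X

/-- A left `A`-module structure on `Y : c ⟶ a` (in the paper's notation the action is a
2-morphism `A ⊗ Y ⟶ Y`, i.e. `Y ≫ A ⟶ Y`). -/
structure LeftModule {c a : B} {A : a ⟶ a} (FA : FrobeniusAlgebra A) (Y : c ⟶ a) where
  act : Y ≫ A ⟶ Y
  act_assoc : (act ▷ A) ≫ act = (α_ Y A A).hom ≫ (Y ◁ FA.mul) ≫ act
  act_one : (ρ_ Y).inv ≫ (Y ◁ FA.one) ≫ act = 𝟙 Y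

/-- The 2-morphism `e = (ρ_X ⊗ ρ_Y) ∘ (id_X ⊗ (Δ ∘ η) ⊗ id_Y) : X ⊗ Y ⟶ X ⊗ Y`
(with associators and unitors inserted); here `X ⊗ Y = Y ≫ X`. -/
def splitIdem {a b c : B} {A : a ⟶ a} {FA : FrobeniusAlgebra A} {X : a ⟶ b} {Y : c ⟶ a}
    (MX : RightModule FA X) (MY : LeftModule FA Y) : Y ≫ X ⟶ Y ≫ X :=
  (((ρ_ Y).inv ≫ (Y ◁ (FA.one ≫ FA.comul)) ≫ (α_ Y A A).inv) ▷ X)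
    ≫ (α_ (Y ≫ A) A X).hom ≫ (MY.act ▷ (A ≫ X)) ≫ (Y ◁ MX.act)

namespace FrobeniusAlgebra

variable {a : B} {A : a ⟶ a} (FA : FrobeniusAlgebra A)

/-- Multiplying the copairing `Δ ∘ η` on its first leg recovers the comultiplication. -/
theorem whiskerLeft_one_comul_mul :
    (ρ_ A).inv ≫ A ◁ (FA.one ≫ FA.comul) ≫ (α_ A A A).inv ≫ FA.mul ▷ A = FA.comul := by
  calc
    _ = (ρ_ A).inv ≫ A ◁ FA.one ≫ (A ◁ FA.comul ≫ (α_ A A A).inv ≫ FA.mul ▷ A) := by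
      simp
    _ = 𝟙 _ ⊗≫ (A ◁ FA.one ≫ FA.comul ▷ A) ⊗≫ A ◁ FA.mul := by
      rw [FA.frobenius]; bicategory
    _ = FA.comul ⊗≫ A ◁ ((ρ_ A).inv ≫ A ◁ FA.one ≫ FA.mul) := by
      rw [whisker_exchange]; bicategory
    _ = FA.comul := by
      rw [FA.mul_one]; bicategory

/-- Multiplying the copairing `Δ ∘ η` on its second leg recovers the comultiplication. -/
theorem one_comul_whiskerRight_mul :
    (λ_ A).inv ≫ (FA.one ≫ FA.comul) ▷ A ≫ (α_ A A A).hom ≫ A ◁ FA.mul = FA.comul := by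
  calc
    _ = (λ_ A).inv ≫ FA.one ▷ A ≫ (FA.comul ▷ A ≫ (α_ A A A).hom ≫ A ◁ FA.mul) := by
      simp
    _ = 𝟙 _ ⊗≫ (FA.one ▷ A ≫ A ◁ FA.comul) ⊗≫ FA.mul ▷ A := by
      rw [← FA.frobenius]; bicategory
    _ = FA.comul ⊗≫ ((λ_ A).inv ≫ FA.one ▷ A ≫ FA.mul) ▷ A := by
      rw [← whisker_exchange]; bicategory
    _ = FA.comul := by
      rw [FA.one_mul]; bicategory

/-- The comultiplication is a morphism of modules for the multiplication on the second leg. -/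
theorem comul_whiskerRight_mul :
    FA.comul ▷ A ≫ (α_ A A A).hom ≫ A ◁ FA.mul = FA.mul ≫ FA.comul := by
  calc
    _ = ((λ_ A).inv ≫ (FA.one ≫ FA.comul) ▷ A ≫ (α_ A A A).hom ≫ A ◁ FA.mul) ▷ A ≫
          (α_ A A A).hom ≫ A ◁ FA.mul := by
      rw [FA.one_comul_whiskerRight_mul]
    _ = 𝟙 _ ⊗≫ (FA.one ≫ FA.comul) ▷ A ▷ A ⊗≫
          A ◁ ((α_ A A A).inv ≫ FA.mul ▷ A ≫ FA.mul) := by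
      bicategory
    _ = 𝟙 _ ⊗≫ ((FA.one ≫ FA.comul) ▷ (A ≫ A) ≫ (A ≫ A) ◁ FA.mul) ⊗≫ A ◁ FA.mul := by
      rw [← FA.mul_assoc]; bicategory
    _ = FA.mul ≫
          ((λ_ A).inv ≫ (FA.one ≫ FA.comul) ▷ A ≫ (α_ A A A).hom ≫ A ◁ FA.mul) := by
      rw [← whisker_exchange]; bicategory
    _ = _ := by
      rw [FA.one_comul_whiskerRight_mul]

/-- Nesting a second copairing inside the copairing `Δ ∘ η` and multiplying the legs pairwise
gives back the copairing. -/
theorem one_comul_nested :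
    (FA.one ≫ FA.comul) ⊗≫ A ◁ (FA.one ≫ FA.comul) ▷ A ⊗≫ FA.mul ▷ A ▷ A ⊗≫ A ◁ FA.mul =
      FA.one ≫ FA.comul := by
  calc
    _ = (FA.one ≫ FA.comul) ≫
          ((ρ_ A).inv ≫ A ◁ (FA.one ≫ FA.comul) ≫ (α_ A A A).inv ≫ FA.mul ▷ A) ▷ A ≫
          (α_ A A A).hom ≫ A ◁ FA.mul := by
      bicategory
    _ = FA.one ≫ (FA.comul ≫ FA.mul) ≫ FA.comul := by
      rw [FA.whiskerLeft_one_comul_mul, FA.comul_whiskerRight_mul]; simp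
    _ = _ := by
      rw [FA.separable]; simp

end FrobeniusAlgebra

/-- STATEMENT 15.  For a Δ-separable Frobenius algebra `A`, a right `A`-module `X` and a
left `A`-module `Y`, the 2-morphism
`e = (ρ_X ⊗ ρ_Y) ∘ (id_X ⊗ (Δ ∘ η) ⊗ id_Y) : X ⊗ Y ⟶ X ⊗ Y` is idempotent. -/
theorem statement15 {a b c : B} {A : a ⟶ a} (FA : FrobeniusAlgebra A) {X : a ⟶ b}
    {Y : c ⟶ a} (MX : RightModule FA X) (MY : LeftModule FA Y) :
    splitIdem MX MY ≫ splitIdem MX MY = splitIdem MX MY := by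
  have expand (k : 𝟙 a ⟶ A ≫ A) :
      (((ρ_ Y).inv ≫ (Y ◁ k) ≫ (α_ Y A A).inv) ▷ X)
        ≫ (α_ (Y ≫ A) A X).hom ≫ (MY.act ▷ (A ≫ X)) ≫ (Y ◁ MX.act) =
      𝟙 _ ⊗≫ Y ◁ k ▷ X ⊗≫ MY.act ▷ (A ≫ X) ⊗≫ Y ◁ MX.act := by
    bicategory
  have nested := FA.one_comul_nested
  unfold splitIdem
  generalize FA.one ≫ FA.comul = k at nested ⊢
  calc
    _ = 𝟙 _ ⊗≫ Y ◁ k ▷ X ⊗≫ MY.act ▷ (A ≫ X) ⊗≫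
          Y ◁ (𝟙 a ◁ MX.act ≫ k ▷ X) ⊗≫ MY.act ▷ (A ≫ X) ⊗≫ Y ◁ MX.act := by
      bicategory
    _ = 𝟙 _ ⊗≫ Y ◁ k ▷ X ⊗≫ (MY.act ▷ (𝟙 a ≫ A ≫ X) ≫ Y ◁ k ▷ (A ≫ X)) ⊗≫
          ((Y ≫ A) ◁ A ◁ MX.act ≫ MY.act ▷ (A ≫ X)) ⊗≫ Y ◁ MX.act := by
      rw [whisker_exchange k MX.act]; bicategory
    _ = 𝟙 _ ⊗≫ Y ◁ k ▷ X ⊗≫ Y ◁ A ◁ k ▷ (A ≫ X) ⊗≫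
          (MY.act ▷ A ≫ MY.act) ▷ (A ≫ A ≫ X) ⊗≫ Y ◁ (A ◁ MX.act ≫ MX.act) := by
      rw [← whisker_exchange MY.act (k ▷ (A ≫ X)), whisker_exchange MY.act (A ◁ MX.act)]
      bicategory
    _ = 𝟙 _ ⊗≫ Y ◁ k ▷ X ⊗≫ Y ◁ A ◁ k ▷ (A ≫ X) ⊗≫ Y ◁ FA.mul ▷ (A ≫ A ≫ X) ⊗≫
          (MY.act ▷ (A ≫ A ≫ X) ≫ Y ◁ ((α_ A A X).inv ≫ FA.mul ▷ X)) ⊗≫ Y ◁ MX.act := by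
      rw [MY.act_assoc, MX.act_assoc]; bicategory
    _ = 𝟙 _ ⊗≫ Y ◁ (k ⊗≫ A ◁ k ▷ A ⊗≫ FA.mul ▷ A ▷ A ⊗≫ A ◁ FA.mul) ▷ X ⊗≫
          MY.act ▷ (A ≫ X) ⊗≫ Y ◁ MX.act := by
      rw [← whisker_exchange]; bicategory
    _ = _ := by
      rw [nested]; bicategory
end

section
/- Let B be a bicategory, A a Δ-separable Frobenius algebra on an object a of B, X : a → b a right A-module with action ρ_X, Y : c → a a left A-module with action ρ_Y, and let e := (ρ_X ⊗ ρ_Y) ∘ (id_X ⊗ (Δ ∘ η) ⊗ id_Y) : X ⊗ Y → X ⊗ Y. Consider the parallel pair of 2-morphisms ρ_X ⊗ id_Y and id_X ⊗ ρ_Y : X ⊗ A ⊗ Y → X ⊗ Y in the hom-category B(c, b) (associators inserted so that both have common source X ⊗ A ⊗ Y). Then this pair admits a coequalizer in B(c, b) if and only if the idempotent e splits in B(c, b); and for any splitting e = Z ∘ S with S : X ⊗ Y → T, Z : T → X ⊗ Y, S ∘ Z = id_T, the morphism S : X ⊗ Y → T is a coequalizer of the pair (so the relative tensor product X ⊗_A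 Y is the image T of e). -/
open CategoryTheory Bicategory

universe w v u

variable {B : Type u} [Bicategory.{w, v} B]

open CategoryTheory.Limits

/-- The first leg `ρ_X ⊗ id_Y` of the parallel pair, with common source
`X ⊗ A ⊗ Y = (Y ≫ A) ≫ X`. -/
def leg₁ {a b c : B} {A : a ⟶ a} {FA : FrobeniusAlgebra A} {X : a ⟶ b} {Y : c ⟶ a}
    (MX : RightModule FA X) (MY : LeftModule FA Y) : (Y ≫ A) ≫ X ⟶ Y ≫ X :=
  (α_ Y A X).hom ≫ (Y ◁ MX.act)

/-- The second leg `id_X ⊗ ρ_Y` of the parallel pair. -/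
def leg₂ {a b c : B} {A : a ⟶ a} {FA : FrobeniusAlgebra A} {X : a ⟶ b} {Y : c ⟶ a}
    (MX : RightModule FA X) (MY : LeftModule FA Y) : (Y ≫ A) ≫ X ⟶ Y ≫ X :=
  MY.act ▷ X

namespace FrobeniusAlgebra

variable {a : B} {A : a ⟶ a} (FA : FrobeniusAlgebra A)

/-- Multiplying the first tensor factor of `Δ ∘ η` recovers `Δ`. -/
lemma mul_copairing :
    (ρ_ A).inv ≫ (A ◁ (FA.one ≫ FA.comul)) ≫ (α_ A A A).inv ≫ (FA.mul ▷ A) = FA.comul := by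
  calc
    _ = (ρ_ A).inv ≫ (A ◁ FA.one) ≫ (A ◁ FA.comul) ≫ (α_ A A A).inv ≫ (FA.mul ▷ A) := by
      simp
    _ = ((ρ_ A).inv ≫ (A ◁ FA.one) ≫ (FA.comul ▷ A)) ≫ (α_ A A A).hom ≫ (A ◁ FA.mul) := by
      simp [FA.frobenius]
    _ = (FA.comul ≫ (ρ_ (A ≫ A)).inv ≫ ((A ≫ A) ◁ FA.one)) ≫
          (α_ A A A).hom ≫ (A ◁ FA.mul) := by
      rw [whisker_exchange, ← rightUnitor_inv_naturality_assoc]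
    _ = FA.comul ≫ (A ◁ ((ρ_ A).inv ≫ (A ◁ FA.one) ≫ FA.mul)) := by
      simp
    _ = FA.comul := by
      rw [FA.mul_one]; simp

/-- Multiplying the second tensor factor of `Δ ∘ η` recovers `Δ`. -/
lemma copairing_mul :
    (λ_ A).inv ≫ ((FA.one ≫ FA.comul) ▷ A) ≫ (α_ A A A).hom ≫ (A ◁ FA.mul) = FA.comul := by
  calc
    _ = (λ_ A).inv ≫ (FA.one ▷ A) ≫ (FA.comul ▷ A) ≫ (α_ A A A).hom ≫ (A ◁ FA.mul) := by
      simp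
    _ = ((λ_ A).inv ≫ (FA.one ▷ A) ≫ (A ◁ FA.comul)) ≫ (α_ A A A).inv ≫ (FA.mul ▷ A) := by
      simp [FA.frobenius]
    _ = (FA.comul ≫ (λ_ (A ≫ A)).inv ≫ (FA.one ▷ (A ≫ A))) ≫
          (α_ A A A).inv ≫ (FA.mul ▷ A) := by
      rw [← whisker_exchange, ← leftUnitor_inv_naturality_assoc]
    _ = FA.comul ≫ (((λ_ A).inv ≫ (FA.one ▷ A) ≫ FA.mul) ▷ A) := by
      simp
    _ = FA.comul := by
      rw [FA.one_mul]; simp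

end FrobeniusAlgebra

namespace LeftModule

variable {a c : B} {A : a ⟶ a} {FA : FrobeniusAlgebra A} {Y : c ⟶ a} (MY : LeftModule FA Y)

/-- The section `Y ⟶ A ⊗ Y` of the action induced by `Δ ∘ η`. -/
def coact : Y ⟶ Y ≫ A :=
  (ρ_ Y).inv ≫ (Y ◁ (FA.one ≫ FA.comul)) ≫ (α_ Y A A).inv ≫ (MY.act ▷ A)

lemma coact_act : MY.coact ≫ MY.act = 𝟙 Y := by
  calc
    _ = (ρ_ Y).inv ≫ (Y ◁ (FA.one ≫ FA.comul ≫ FA.mul)) ≫ MY.act := by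
      simp [coact, MY.act_assoc]
    _ = 𝟙 Y := by
      rw [FA.separable, Category.comp_id, MY.act_one]

lemma act_coact :
    MY.act ≫ MY.coact = (Y ◁ FA.comul) ≫ (α_ Y A A).inv ≫ (MY.act ▷ A) := by
  calc
    _ = (ρ_ (Y ≫ A)).inv ≫ ((MY.act ▷ 𝟙 a) ≫ (Y ◁ (FA.one ≫ FA.comul))) ≫
          (α_ Y A A).inv ≫ (MY.act ▷ A) := by
      rw [coact, rightUnitor_inv_naturality_assoc, Category.assoc]
    _ = (ρ_ (Y ≫ A)).inv ≫ ((Y ≫ A) ◁ (FA.one ≫ FA.comul)) ≫ (α_ (Y ≫ A) A A).inv ≫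
          ((MY.act ▷ A) ≫ MY.act) ▷ A := by
      rw [← whisker_exchange]
      simp
    _ = (Y ◁ ((ρ_ A).inv ≫ (A ◁ (FA.one ≫ FA.comul)) ≫ (α_ A A A).inv ≫ (FA.mul ▷ A))) ≫
          (α_ Y A A).inv ≫ (MY.act ▷ A) := by
      rw [MY.act_assoc]
      simp
    _ = _ := by
      rw [FA.mul_copairing]

lemma coact_mul :
    (MY.coact ▷ A) ≫ (α_ Y A A).hom ≫ (Y ◁ FA.mul) = MY.act ≫ MY.coact := by
  calc
    _ = ((ρ_ Y).inv ▷ A) ≫ ((Y ◁ (FA.one ≫ FA.comul)) ▷ A) ≫ ((α_ Y A A).inv ▷ A) ≫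
          (α_ (Y ≫ A) A A).hom ≫ ((MY.act ▷ (A ≫ A)) ≫ (Y ◁ FA.mul)) := by
      simp [coact]
    _ = (Y ◁ ((λ_ A).inv ≫ ((FA.one ≫ FA.comul) ▷ A) ≫ (α_ A A A).hom ≫ (A ◁ FA.mul))) ≫
          (α_ Y A A).inv ≫ (MY.act ▷ A) := by
      rw [← whisker_exchange]
      simp
    _ = _ := by
      rw [FA.copairing_mul, act_coact]

end LeftModule

section

variable {a b c : B} {A : a ⟶ a} {FA : FrobeniusAlgebra A} {X : a ⟶ b} {Y : c ⟶ a}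
  (MX : RightModule FA X) (MY : LeftModule FA Y)

lemma splitIdem_eq : splitIdem MX MY = (MY.coact ▷ X) ≫ leg₁ MX MY := by
  simp [splitIdem, LeftModule.coact, leg₁]

lemma leg₁_splitIdem : leg₁ MX MY ≫ splitIdem MX MY = leg₂ MX MY ≫ splitIdem MX MY := by
  calc
    _ = (α_ Y A X).hom ≫ ((Y ◁ MX.act) ≫ (MY.coact ▷ X)) ≫ (α_ Y A X).hom ≫
          (Y ◁ MX.act) := by
      simp [splitIdem_eq, leg₁]
    _ = (α_ Y A X).hom ≫ (MY.coact ▷ (A ≫ X)) ≫ (α_ Y A (A ≫ X)).hom ≫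
          (Y ◁ ((A ◁ MX.act) ≫ MX.act)) := by
      rw [whisker_exchange]
      simp
    _ = (((MY.coact ▷ A) ≫ (α_ Y A A).hom ≫ (Y ◁ FA.mul)) ▷ X) ≫ leg₁ MX MY := by
      rw [MX.act_assoc]
      simp [leg₁]
    _ = _ := by
      rw [MY.coact_mul, splitIdem_eq, leg₂, comp_whiskerRight, Category.assoc]

lemma splitIdem_comp {T : c ⟶ b} (h : Y ≫ X ⟶ T) (w : leg₁ MX MY ≫ h = leg₂ MX MY ≫ h) :
    splitIdem MX MY ≫ h = h := by
  rw [splitIdem_eq, Category.assoc, w, leg₂, ← comp_whiskerRight_assoc, MY.coact_act,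
    id_whiskerRight, Category.id_comp]

/-- A splitting of `splitIdem` exhibits its image as the coequalizer of the two legs. -/
lemma isCoequalizer_of_splitting {T : c ⟶ b} (s : Y ≫ X ⟶ T) (z : T ⟶ Y ≫ X)
    (hsz : s ≫ z = splitIdem MX MY) (hzs : z ≫ s = 𝟙 T) :
    ∃ w : leg₁ MX MY ≫ s = leg₂ MX MY ≫ s, Nonempty (IsColimit (Cofork.ofπ s w)) := by
  have hs : s = splitIdem MX MY ≫ s := by
    rw [← hsz, Category.assoc, hzs, Category.comp_id]
  have w : leg₁ MX MY ≫ s = leg₂ MX MY ≫ s := by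
    rw [hs, ← Category.assoc, leg₁_splitIdem, Category.assoc]
  refine ⟨w, ⟨Cofork.IsColimit.mk _ (fun t => z ≫ t.π) (fun t => ?_) (fun t m hm => ?_)⟩⟩
  · change s ≫ z ≫ t.π = t.π
    rw [← Category.assoc, hsz, splitIdem_comp MX MY _ t.condition]
  · change s ≫ m = t.π at hm
    rw [← hm, ← Category.assoc, hzs]
    exact (Category.id_comp m).symm

end

/-- STATEMENT 16.  The parallel pair `ρ_X ⊗ id_Y, id_X ⊗ ρ_Y : X ⊗ A ⊗ Y ⟶ X ⊗ Y` in the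
hom-category `B(c, b)` admits a coequalizer if and only if the idempotent
`e = (ρ_X ⊗ ρ_Y) ∘ (id_X ⊗ (Δ ∘ η) ⊗ id_Y)` splits; and for any splitting `e = Z ∘ S`,
`id = S ∘ Z`, the morphism `S` is a coequalizer of the pair (so the relative tensor product
`X ⊗_A Y` is the image of `e`). -/
theorem statement16 {a b c : B} {A : a ⟶ a} (FA : FrobeniusAlgebra A) {X : a ⟶ b}
    {Y : c ⟶ a} (MX : RightModule FA X) (MY : LeftModule FA Y) :
    (HasCoequalizer (leg₁ MX MY) (leg₂ MX MY) ↔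
      ∃ (T : c ⟶ b) (s : Y ≫ X ⟶ T) (z : T ⟶ Y ≫ X),
        s ≫ z = splitIdem MX MY ∧ z ≫ s = 𝟙 T)
    ∧ (∀ (T : c ⟶ b) (s : Y ≫ X ⟶ T) (z : T ⟶ Y ≫ X),
        s ≫ z = splitIdem MX MY → z ≫ s = 𝟙 T →
        ∃ w : leg₁ MX MY ≫ s = leg₂ MX MY ≫ s,
          Nonempty (IsColimit (Cofork.ofπ s w))) := by
  refine ⟨⟨fun _ => ?_, fun ⟨T, s, z, hsz, hzs⟩ => ?_⟩, fun T s z hsz hzs => ?_⟩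
  · refine ⟨_, coequalizer.π (leg₁ MX MY) (leg₂ MX MY),
      coequalizer.desc (splitIdem MX MY) (leg₁_splitIdem MX MY), coequalizer.π_desc _ _, ?_⟩
    apply coequalizer.hom_ext
    rw [coequalizer.π_desc_assoc, splitIdem_comp MX MY _ (coequalizer.condition _ _),
      Category.comp_id]
  · obtain ⟨w, ⟨hc⟩⟩ := isCoequalizer_of_splitting MX MY s z hsz hzs
    exact ⟨⟨_, hc⟩⟩
  · exact isCoequalizer_of_splitting MX MY s z hsz hzs
end
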